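/- Let 𝔽_q be a finite field with char(𝔽_q) ≠ 2, 3, and let ω be a primitive cube root of unity in the algebraic closure. For the pencil t ↦ (Xt − Ys)·2(Ys² + XYst + Xt²) arising from the secant line with quartic X²Y²: for (s,t) with st ≠ 0, the cubic 2(Xt − Ys)(Xt − Yωs)(Xt − Yω²s) splits into three distinct linear factors over 𝔽_q if and only if q ≡ 1 mod 3. Consequently, if S denotes the q+1 points of the real secant line L = span(XY·X, XY·Y) = {XY(μX + νY)}... then |S ∩ O₃| = (μ+1)(q−1)/6, |S ∩ O₄| = (1−μ)(q−1)/2, and |S ∩ O₅| = (μ+1)(q−1)/3, where q ≡ μ mod 3, μ ∈ {±1}. -/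

import Mathlib

open MvPolynomial

/-- A binary cubic form has three distinct linear factors over `F`
(membership in the orbit `O₃` of `XY(X−Y)`). -/
noncomputable def hasThreeDistinctLinearFactors {F : Type*} [Field F]
    (f : MvPolynomial (Fin 2) F) : Prop :=
  ∃ c a1 b1 a2 b2 a3 b3 : F, c ≠ 0 ∧
    a1 * b2 - a2 * b1 ≠ 0 ∧ a1 * b3 - a3 * b1 ≠ 0 ∧ a2 * b3 - a3 * b2 ≠ 0 ∧
    f = C c * (C a1 * X 0 + C b1 * X 1) * (C a2 * X 0 + C b2 * X 1) *
      (C a3 * X 0 + C b3 * X 1)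

/-- A binary cubic form is a rational linear form times an irreducible
quadratic form (membership in the orbit `O₄` of `X(X²−εY²)`). -/
noncomputable def hasOneLinearFactor {F : Type*} [Field F]
    (f : MvPolynomial (Fin 2) F) : Prop :=
  ∃ (c a b : F) (g : MvPolynomial (Fin 2) F), c ≠ 0 ∧ (a, b) ≠ (0, 0) ∧
    Irreducible g ∧ g.IsHomogeneous 2 ∧
    f = C c * (C a * X 0 + C b * X 1) * g

section Helpers

variable {F : Type*} [Field F]

theorem secant_irred_of_map (p : MvPolynomial (Fin 2) F)
    (hm : (finSuccEquiv F 1 p).Monic)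
    (hi : Irreducible ((finSuccEquiv F 1 p).map (eval (fun _ => (1 : F))))) :
    Irreducible p := by
  have h := Polynomial.Monic.irreducible_of_irreducible_map (eval (fun _ => (1 : F))) _ hm hi
  exact (MulEquiv.irreducible_iff (finSuccEquiv F 1)).1 h

theorem secant_fse_one : finSuccEquiv F 1 (X 1) = Polynomial.C (X 0) :=
  finSuccEquiv_X_succ (j := (0 : Fin 1))

theorem secant_fse_C (a : F) : finSuccEquiv F 1 (C a) = Polynomial.C (C a) := by
  simp [finSuccEquiv_apply]

theorem secant_cubic_irred (t : F) (h : ∀ u : F, u ^ 3 ≠ t) :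
    Irreducible ((X 0) ^ 3 + C t * (X 1) ^ 3 : MvPolynomial (Fin 2) F) := by
  have e : finSuccEquiv F 1 ((X 0) ^ 3 + C t * (X 1) ^ 3) =
      Polynomial.X ^ 3 + Polynomial.C (C t * X 0 ^ 3) := by
    simp only [map_add, map_mul, map_pow, finSuccEquiv_X_zero, secant_fse_one, secant_fse_C]
  apply secant_irred_of_map
  · rw [e]
    exact Polynomial.monic_X_pow_add_C _ (by norm_num)
  · rw [e]
    have h' := X_pow_sub_C_irreducible_of_prime (K := F) Nat.prime_three (a := -t) (by
      intro b hb
      exact h (-b) (by linear_combination -hb))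
    simpa using h'

theorem secant_quad_irred (u : F) (hu : u ≠ 0) (h : ∀ w : F, w ^ 3 = 1 → w = 1)
    (h3 : (3 : F) ≠ 0) :
    Irreducible ((X 0) ^ 2 - C u * X 0 * X 1 + C (u ^ 2) * (X 1) ^ 2 :
      MvPolynomial (Fin 2) F) := by
  have e : finSuccEquiv F 1 ((X 0) ^ 2 - C u * X 0 * X 1 + C (u ^ 2) * (X 1) ^ 2) =
      Polynomial.X ^ 2 + (Polynomial.C (- (C u * X 0)) * Polynomial.X
        + Polynomial.C (C (u ^ 2) * X 0 ^ 2)) := by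
    simp only [map_add, map_sub, map_neg, map_mul, map_pow, finSuccEquiv_X_zero,
      secant_fse_one, secant_fse_C]
    ring
  have hm : (finSuccEquiv F 1
      ((X 0) ^ 2 - C u * X 0 * X 1 + C (u ^ 2) * (X 1) ^ 2)).Monic := by
    rw [e]
    apply Polynomial.monic_X_pow_add
    exact lt_of_le_of_lt Polynomial.degree_linear_le (by norm_num)
  apply secant_irred_of_map _ hm
  apply Polynomial.irreducible_of_degree_le_three_of_not_isRoot
  · rw [hm.natDegree_map, e]
    have : (Polynomial.X ^ 2 + (Polynomial.C (- (C u * X 0)) * Polynomial.X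
        + Polynomial.C (C (u ^ 2) * X 0 ^ 2)) : Polynomial (MvPolynomial (Fin 1) F)).natDegree
        = 2 := by
      rw [← add_assoc]
      compute_degree!
    rw [this]
    simp
  · intro x hx
    rw [e] at hx
    simp at hx
    have hx3 : (-x / u) ^ 3 = 1 := by
      field_simp
      linear_combination -(x + u) * hx
    have h1 := h _ hx3
    have h2 : -x = u := by field_simp at h1; exact h1
    have : (3 : F) * u ^ 2 = 0 := by
      rw [← hx, ← h2]; ring
    simp [h3, hu] at this

/-- product of three linear factors -/
theorem secant_factor (a b w : F) (hw : w ^ 2 + w + 1 = 0) :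
    (C (a ^ 3) * (X 0) ^ 3 + C (b ^ 3) * (X 1) ^ 3 : MvPolynomial (Fin 2) F) =
    C 1 * (C a * X 0 + C b * X 1) * (C a * X 0 + C (w * b) * X 1) *
      (C a * X 0 + C (w ^ 2 * b) * X 1) := by
  have hC : (C w ^ 2 + C w + 1 : MvPolynomial (Fin 2) F) = 0 := by
    rw [← C_pow, ← C_add, ← C_1, ← C_add, hw, C_0]
  simp only [C_mul, C_pow, C_1]
  linear_combination (-(C a ^ 2 * C b * X 0 ^ 2 * X 1 + C w * C a * C b ^ 2 * X 0 * X 1 ^ 2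
    + C b ^ 3 * X 1 ^ 3 * (C w - 1))) * hC

theorem secant_quad_of_cube {w : F} (hw : w ^ 3 = 1) (hw1 : w ≠ 1) : w ^ 2 + w + 1 = 0 := by
  have : (w - 1) * (w ^ 2 + w + 1) = 0 := by linear_combination hw
  exact (mul_eq_zero.1 this).resolve_left (sub_ne_zero.2 hw1)

theorem secant_three_of (h3 : (3 : F) ≠ 0) (a b w : F) (hw : w ^ 3 = 1) (hw1 : w ≠ 1)
    (ha : a ≠ 0) (hb : b ≠ 0) :
    hasThreeDistinctLinearFactors
      (C (a ^ 3) * (X 0) ^ 3 + C (b ^ 3) * (X 1) ^ 3 : MvPolynomial (Fin 2) F) := by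
  have hw0 : w ≠ 0 := by rintro rfl; simp at hw
  have hw2 : w ^ 2 ≠ 1 := by
    intro h
    apply hw1
    linear_combination hw - w * h
  refine ⟨1, a, b, a, w * b, a, w ^ 2 * b, one_ne_zero, ?_, ?_, ?_,
    secant_factor a b w (secant_quad_of_cube hw hw1)⟩
  · rw [show a * (w * b) - a * b = a * b * (w - 1) by ring]
    exact mul_ne_zero (mul_ne_zero ha hb) (sub_ne_zero.2 hw1)
  · rw [show a * (w ^ 2 * b) - a * b = a * b * (w ^ 2 - 1) by ring]
    exact mul_ne_zero (mul_ne_zero ha hb) (sub_ne_zero.2 hw2)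
  · rw [show a * (w ^ 2 * b) - a * (w * b) = a * b * w * (w - 1) by ring]
    exact mul_ne_zero (mul_ne_zero (mul_ne_zero ha hb) hw0) (sub_ne_zero.2 hw1)

theorem secant_of_three (a b : F) (ha : a ≠ 0)
    (h : hasThreeDistinctLinearFactors
      (C a * (X 0) ^ 3 + C b * (X 1) ^ 3 : MvPolynomial (Fin 2) F)) :
    b ≠ 0 ∧ (∃ w : F, w ^ 3 = 1 ∧ w ≠ 1) ∧ ∃ u : F, a * u ^ 3 = b := by
  obtain ⟨c, a1, b1, a2, b2, a3, b3, hc, h12, h13, h23, e⟩ := h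
  have ev : ∀ x y : F, a * x ^ 3 + b * y ^ 3 =
      c * (a1 * x + b1 * y) * (a2 * x + b2 * y) * (a3 * x + b3 * y) := by
    intro x y
    have := congrArg (eval ![x, y]) e
    simpa using this
  have e1 : a * b1 ^ 3 = b * a1 ^ 3 := by
    linear_combination ev b1 (-a1)
  have e2 : a * b2 ^ 3 = b * a2 ^ 3 := by
    linear_combination ev b2 (-a2)
  have hb : b ≠ 0 := by
    rintro rfl
    have z1 : b1 = 0 := by simpa [ha] using e1
    have z2 : b2 = 0 := by simpa [ha] using e2
    apply h12; rw [z1, z2]; ring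
  have ha1 : a1 ≠ 0 := by
    rintro rfl
    have z1 : b1 = 0 := by simpa [ha] using e1
    apply h12; rw [z1]; ring
  have ha2 : a2 ≠ 0 := by
    rintro rfl
    have z1 : b2 = 0 := by simpa [ha] using e2
    apply h12; rw [z1]; ring
  have hb1 : b1 ≠ 0 := by
    rintro rfl
    have := e1.symm
    simp [hb, ha1] at this
  refine ⟨hb, ⟨(b2 * a1) / (b1 * a2), ?_, ?_⟩, b1 / a1, ?_⟩
  · rw [div_pow, div_eq_one_iff_eq (pow_ne_zero _ (mul_ne_zero hb1 ha2))]
    apply mul_left_cancel₀ ha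
    linear_combination a1 ^ 3 * e2 - a2 ^ 3 * e1
  · intro h
    rw [div_eq_one_iff_eq (mul_ne_zero hb1 ha2)] at h
    apply h12; linear_combination h
  · field_simp
    linear_combination e1

theorem secant_cube_factor (u : F) :
    ((X 0) ^ 3 + C (u ^ 3) * (X 1) ^ 3 : MvPolynomial (Fin 2) F) =
    C 1 * (C 1 * X 0 + C u * X 1) *
      ((X 0) ^ 2 - C u * X 0 * X 1 + C (u ^ 2) * (X 1) ^ 2) := by
  simp only [C_pow, C_1]
  ring

theorem secant_irred_iff (t : F) :
    Irreducible ((X 0) ^ 3 + C t * (X 1) ^ 3 : MvPolynomial (Fin 2) F) ↔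
      ∀ u : F, u ^ 3 ≠ t := by
  refine ⟨?_, secant_cubic_irred t⟩
  rintro h u rfl
  rw [secant_cube_factor] at h
  rcases h.isUnit_or_isUnit rfl with h' | h'
  · have := h'.map (eval (0 : Fin 2 → F))
    simp at this
  · have := h'.map (eval (0 : Fin 2 → F))
    simp at this

theorem secant_one_of (h3 : (3 : F) ≠ 0) (u : F) (hu : u ≠ 0)
    (h : ∀ w : F, w ^ 3 = 1 → w = 1) :
    hasOneLinearFactor ((X 0) ^ 3 + C (u ^ 3) * (X 1) ^ 3 : MvPolynomial (Fin 2) F) := by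
  refine ⟨1, 1, u, _, one_ne_zero, by simp, secant_quad_irred u hu h h3, ?_,
    secant_cube_factor u⟩
  refine ((isHomogeneous_X_pow _ _).sub ?_).add ?_
  · have := ((isHomogeneous_C (Fin 2) u).mul (isHomogeneous_X F 0)).mul (isHomogeneous_X F 1)
    simpa using this
  · have := (isHomogeneous_C (Fin 2) (u ^ 2)).mul (isHomogeneous_X_pow (R := F) (1 : Fin 2) 2)
    simpa using this

theorem secant_of_one (t : F) (h : hasOneLinearFactor
    ((X 0) ^ 3 + C t * (X 1) ^ 3 : MvPolynomial (Fin 2) F)) :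
    (∃ u : F, u ^ 3 = t) ∧ ∀ u w : F, u ^ 3 = t → w ^ 2 + w + 1 = 0 → False := by
  obtain ⟨c, a, b, g, hc, hab, hg, hg2, e⟩ := h
  constructor
  · have ev := congrArg (eval ![b, -a]) e
    simp at ev
    have ev' : b ^ 3 = t * a ^ 3 := by
      linear_combination ev
    have ha : a ≠ 0 := by
      rintro rfl
      apply hab
      simpa using ev'
    refine ⟨b / a, ?_⟩
    field_simp
    linear_combination ev'
  · rintro u w rfl hw
    have hf := secant_factor 1 u w hw
    rw [one_pow, C_1, one_mul, e] at hf
    have hd : g ∣ C c * (C a * X 0 + C b * X 1) * g := dvd_mul_left _ _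
    rw [hf] at hd
    have key : ∀ v : F, ¬ g ∣ (1 * X 0 + C v * X 1 : MvPolynomial (Fin 2) F) := by
      intro v hv
      have hne : (1 * X 0 + C v * X 1 : MvPolynomial (Fin 2) F) ≠ 0 := by
        intro h0
        have := congrArg (eval ![1, 0]) h0
        simp at this
      have hle := totalDegree_le_of_dvd_of_isDomain hv hne
      rw [hg2.totalDegree hg.ne_zero] at hle
      have hl : (1 * X 0 + C v * X 1 : MvPolynomial (Fin 2) F).IsHomogeneous 1 := by
        refine IsHomogeneous.add ?_ ?_
        · simpa using isHomogeneous_X F (0 : Fin 2)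
        · simpa using (isHomogeneous_C (Fin 2) v).mul (isHomogeneous_X F (1 : Fin 2))
      have := hl.totalDegree_le
      omega
    rw [one_mul] at hd
    rcases hg.prime.dvd_or_dvd hd with hd | hd
    · rcases hg.prime.dvd_or_dvd hd with hd | hd
      · exact key _ hd
      · exact key _ hd
    · exact key _ hd

variable [Fintype F]

theorem secant_root_dvd {w : F} (hw : w ^ 3 = 1) (hw1 : w ≠ 1) : 3 ∣ Fintype.card F - 1 := by
  have hw0 : w ≠ 0 := by rintro rfl; simp at hw
  have ho : orderOf w = 3 := by
    haveI : Fact (Nat.Prime 3) := ⟨Nat.prime_three⟩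
    exact orderOf_eq_prime hw hw1
  rw [← ho]
  exact orderOf_dvd_of_pow_eq_one (FiniteField.pow_card_sub_one_eq_one w hw0)

theorem secant_exists_root (h : 3 ∣ Fintype.card F - 1) : ∃ w : F, w ^ 3 = 1 ∧ w ≠ 1 := by
  classical
  haveI : Fact (Nat.Prime 3) := ⟨Nat.prime_three⟩
  rw [← Fintype.card_units] at h
  obtain ⟨x, hx⟩ := exists_prime_orderOf_dvd_card 3 h
  refine ⟨x, ?_, ?_⟩
  · have := pow_orderOf_eq_one x
    rw [hx] at this
    rw [← Units.val_pow_eq_pow_val, this, Units.val_one]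
  · intro h1
    have : x = 1 := Units.ext h1
    rw [this, orderOf_one] at hx
    omega

theorem secant_card_cubes (h : 3 ∣ Fintype.card F - 1) :
    3 * Set.ncard {t : F | t ≠ 0 ∧ ∃ u : F, u ^ 3 = t} = Fintype.card F - 1 := by
  classical
  have hr := IsCyclic.card_powMonoidHom_range (G := Fˣ) 3
  rw [Nat.card_eq_fintype_card (α := Fˣ), Fintype.card_units, Nat.gcd_eq_right h] at hr
  have hs : {t : F | t ≠ 0 ∧ ∃ u : F, u ^ 3 = t} =
      Units.val '' ((powMonoidHom 3 : Fˣ →* Fˣ).range : Set Fˣ) := by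
    ext t
    constructor
    · rintro ⟨ht, u, rfl⟩
      have hu : u ≠ 0 := by rintro rfl; simp at ht
      exact ⟨Units.mk0 u hu ^ 3, ⟨Units.mk0 u hu, rfl⟩, by simp⟩
    · rintro ⟨_, ⟨v, rfl⟩, rfl⟩
      exact ⟨Units.ne_zero _, v, by simp⟩
  rw [hs, Set.ncard_image_of_injective _ Units.val_injective, ← Nat.card_coe_set_eq]
  have hr' : Nat.card ((powMonoidHom 3 : Fˣ →* Fˣ).range : Set Fˣ) =
    (Fintype.card F - 1) / 3 := hr
  rw [hr']
  omega

theorem secant_card_ne_zero : Set.ncard {t : F | t ≠ 0} = Fintype.card F - 1 := by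
  have h := Set.ncard_add_ncard_compl ({0} : Set F)
  rw [Set.ncard_singleton, Nat.card_eq_fintype_card] at h
  have : {t : F | t ≠ 0} = ({0} : Set F)ᶜ := by ext; simp
  rw [this]
  omega

end Helpers

/-- The pencil of the real secant line of the twisted cubic through `X³` and
`Y³` consists of the cubics `μX³ + νY³`; the distribution of its points among
the orbits `O₃`, `O₄`, `O₅` is `(μ+1)(q−1)/6`, `(1−μ)(q−1)/2`, `(μ+1)(q−1)/3`
where `q ≡ μ mod 3`. -/
theorem real_secant_orbit_distribution {F : Type*} [Field F] [Fintype F]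
    (h2 : (2 : F) ≠ 0) (h3 : (3 : F) ≠ 0) (hq4 : 4 < Fintype.card F)
    (μ : ℤ) (hμ : μ = 1 ∨ μ = -1)
    (hqμ : (Fintype.card F : ℤ) ≡ μ [ZMOD 3]) :
    (∀ s t : F, s ≠ 0 → t ≠ 0 →
      (hasThreeDistinctLinearFactors
          (C (t ^ 3) * (X 0) ^ 3 - C (s ^ 3) * (X 1) ^ 3 : MvPolynomial (Fin 2) F) ↔
        μ = 1)) ∧
    6 * (Set.ncard {t : F | hasThreeDistinctLinearFactors
        ((X 0) ^ 3 + C t * (X 1) ^ 3 : MvPolynomial (Fin 2) F)} : ℤ) =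
      (μ + 1) * (Fintype.card F - 1) ∧
    2 * (Set.ncard {t : F | hasOneLinearFactor
        ((X 0) ^ 3 + C t * (X 1) ^ 3 : MvPolynomial (Fin 2) F)} : ℤ) =
      (1 - μ) * (Fintype.card F - 1) ∧
    3 * (Set.ncard {t : F | Irreducible
        ((X 0) ^ 3 + C t * (X 1) ^ 3 : MvPolynomial (Fin 2) F)} : ℤ) =
      (μ + 1) * (Fintype.card F - 1) := by
  have hq1 : 1 ≤ Fintype.card F := by omega
  have hcast : ((Fintype.card F - 1 : ℕ) : ℤ) = (Fintype.card F : ℤ) - 1 := by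
    push_cast [hq1]; ring
  have hsub : ∀ s t : F, (C (t ^ 3) * (X 0) ^ 3 - C (s ^ 3) * (X 1) ^ 3 :
      MvPolynomial (Fin 2) F) = C (t ^ 3) * (X 0) ^ 3 + C ((-s) ^ 3) * (X 1) ^ 3 := by
    intro s t
    rw [show (-s) ^ 3 = -(s ^ 3) by ring, C_neg]
    ring
  have hone : ∀ t : F, ((X 0) ^ 3 + C t * (X 1) ^ 3 : MvPolynomial (Fin 2) F) =
      C 1 * (X 0) ^ 3 + C t * (X 1) ^ 3 := by
    intro t
    rw [C_1, one_mul]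
  have hS3 : ∀ t : F, hasThreeDistinctLinearFactors
      ((X 0) ^ 3 + C t * (X 1) ^ 3 : MvPolynomial (Fin 2) F) →
      t ≠ 0 ∧ (∃ w : F, w ^ 3 = 1 ∧ w ≠ 1) ∧ ∃ u : F, u ^ 3 = t := by
    intro t h
    rw [hone] at h
    simpa using secant_of_three 1 t one_ne_zero h
  rcases hμ with rfl | rfl
  · have hd : 3 ∣ Fintype.card F - 1 := by
      unfold Int.ModEq at hqμ
      omega
    obtain ⟨w, hw, hw1⟩ := secant_exists_root hd
    have hcub := secant_card_cubes hd
    refine ⟨?_, ?_, ?_, ?_⟩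
    · intro s t hs ht
      rw [hsub]
      exact ⟨fun _ => rfl, fun _ => secant_three_of h3 t (-s) w hw hw1 ht (neg_ne_zero.2 hs)⟩
    · have : {t : F | hasThreeDistinctLinearFactors
          ((X 0) ^ 3 + C t * (X 1) ^ 3 : MvPolynomial (Fin 2) F)} =
          {t : F | t ≠ 0 ∧ ∃ u : F, u ^ 3 = t} := by
        ext t
        constructor
        · intro h
          exact ⟨(hS3 t h).1, (hS3 t h).2.2⟩
        · rintro ⟨ht, u, rfl⟩
          have hu : u ≠ 0 := by rintro rfl; simp at ht
          have := secant_three_of h3 1 u w hw hw1 one_ne_zero hu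
          rw [one_pow, ← hone] at this
          exact this
      rw [this]
      omega
    · have : {t : F | hasOneLinearFactor
          ((X 0) ^ 3 + C t * (X 1) ^ 3 : MvPolynomial (Fin 2) F)} = ∅ := by
        apply Set.eq_empty_of_forall_notMem
        intro t h
        obtain ⟨⟨u, hu⟩, hno⟩ := secant_of_one t h
        exact hno u w hu (secant_quad_of_cube hw hw1)
      rw [this]
      simp
    · have : {t : F | Irreducible
          ((X 0) ^ 3 + C t * (X 1) ^ 3 : MvPolynomial (Fin 2) F)} =
          {t : F | t ≠ 0} \ {t : F | t ≠ 0 ∧ ∃ u : F, u ^ 3 = t} := by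
        ext t
        simp only [Set.mem_setOf_eq, secant_irred_iff, Set.mem_diff, not_and, not_exists]
        constructor
        · intro h
          refine ⟨?_, fun _ => h⟩
          rintro rfl
          exact h 0 (by simp)
        · rintro ⟨h, h'⟩
          exact h' h
      have hc := Set.ncard_diff_add_ncard_of_subset
        (s := {t : F | t ≠ 0 ∧ ∃ u : F, u ^ 3 = t}) (t := {t : F | t ≠ 0})
        (fun t ht => ht.1)
      rw [secant_card_ne_zero] at hc
      rw [this]
      omega
  · have hnw : ∀ w : F, w ^ 3 = 1 → w = 1 := by
      intro w hw
      by_contra hw1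
      have := secant_root_dvd hw hw1
      unfold Int.ModEq at hqμ
      omega
    have hinj : Function.Injective (fun x : F => x ^ 3) := by
      intro x y hxy
      simp only at hxy
      by_cases hy : y = 0
      · subst hy
        simpa using hxy
      · have h1 : (x / y) ^ 3 = 1 := by
          rw [div_pow, hxy, div_self (pow_ne_zero _ hy)]
        exact (div_eq_one_iff_eq hy).1 (hnw _ h1)
    have hsurj := Finite.surjective_of_injective hinj
    refine ⟨?_, ?_, ?_, ?_⟩
    · intro s t hs ht
      rw [hsub]
      refine ⟨fun h => ?_, fun h => by omega⟩
      obtain ⟨-, ⟨w, hw, hw1⟩, -⟩ := secant_of_three _ _ (pow_ne_zero 3 ht) h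
      exact absurd (hnw w hw) hw1
    · have : {t : F | hasThreeDistinctLinearFactors
          ((X 0) ^ 3 + C t * (X 1) ^ 3 : MvPolynomial (Fin 2) F)} = ∅ := by
        apply Set.eq_empty_of_forall_notMem
        intro t h
        obtain ⟨-, ⟨w, hw, hw1⟩, -⟩ := hS3 t h
        exact hw1 (hnw w hw)
      rw [this]
      simp
    · have : {t : F | hasOneLinearFactor
          ((X 0) ^ 3 + C t * (X 1) ^ 3 : MvPolynomial (Fin 2) F)} = {t : F | t ≠ 0} := by
        ext t
        constructor
        · rintro h rfl
          obtain ⟨c, a, b, g, hc, hab, hg, hg2, e⟩ := h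
          have hd : g ∣ (X 0 : MvPolynomial (Fin 2) F) ^ 3 := by
            rw [C_0, zero_mul, add_zero] at e
            rw [e]
            exact dvd_mul_left _ _
          have hd' := hg.prime.dvd_of_dvd_pow hd
          have hle := totalDegree_le_of_dvd_of_isDomain hd' (X_ne_zero _)
          rw [hg2.totalDegree hg.ne_zero, totalDegree_X] at hle
          omega
        · intro ht
          obtain ⟨u, rfl⟩ := hsurj t
          have hu : u ≠ 0 := by rintro rfl; simp at ht
          exact secant_one_of h3 u hu hnw
      rw [this, secant_card_ne_zero]
      omega
    · have : {t : F | Irreducible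
          ((X 0) ^ 3 + C t * (X 1) ^ 3 : MvPolynomial (Fin 2) F)} = ∅ := by
        apply Set.eq_empty_of_forall_notMem
        intro t h
        obtain ⟨u, hu⟩ := hsurj t
        exact (secant_irred_iff t).1 h u hu
      rw [this]
      simp
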